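/- arXiv:0908.2179 — 6 statements merged into one kernel-verified Lean document; each statement's English description precedes it below -/
import Mathlib

section
/- Let K be a field and n ≥ 2 an integer. For all words I, J, K', L in the alphabet {1,…,n}, the product of basis elements in C_K(n) is given by: (x_I y_J)(x_{K'} y_L) = 0 if J^rev ≁ K'; (x_I y_J)(x_{K'} y_L) = x_{IM} y_L if J^rev ≤ K' with K' = J^rev M for some word M; and (x_I y_J)(x_{K'} y_L) = x_I y_{N^rev L} if K' ≤ J^rev with J^rev = K' N for some word N. -/
noncomputable section

open scoped BigOperators

/-- The defining relations of the Cohn algebra `C_K(n)`: `y_i x_j = δ_{ij} 1`.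
Generators of the free algebra: `Sum.inl i` is `x_i`, `Sum.inr i` is `y_i`.
Quotienting by this relation is the same as quotienting by the two-sided ideal
generated by the elements `y_i x_j - δ_{ij} 1`. -/
inductive CohnRel (K : Type) [Field K] (n : ℕ) :
    FreeAlgebra K (Fin n ⊕ Fin n) → FreeAlgebra K (Fin n ⊕ Fin n) → Prop
  | rel (i j : Fin n) : CohnRel K n
      (FreeAlgebra.ι K (Sum.inr i) * FreeAlgebra.ι K (Sum.inl j))
      (if i = j then 1 else 0)

/-- The Cohn algebra `C_K(n)`. -/
abbrev CohnAlgebra (K : Type) [Field K] (n : ℕ) := RingQuot (CohnRel K n)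

/-- The generator `x_i` of the Cohn algebra. -/
def cX (K : Type) [Field K] (n : ℕ) (i : Fin n) : CohnAlgebra K n :=
  RingQuot.mkAlgHom K (CohnRel K n) (FreeAlgebra.ι K (Sum.inl i))

/-- The generator `y_i` of the Cohn algebra. -/
def cY (K : Type) [Field K] (n : ℕ) (i : Fin n) : CohnAlgebra K n :=
  RingQuot.mkAlgHom K (CohnRel K n) (FreeAlgebra.ι K (Sum.inr i))

/-- `x_I` for a word `I` in the alphabet `{1, …, n}` (words are lists, the empty
list being the empty word, with `x_φ = 1`). -/
def xw (K : Type) [Field K] (n : ℕ) (I : List (Fin n)) : CohnAlgebra K n :=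
  (I.map (cX K n)).prod

/-- `y_I` for a word `I`. -/
def yw (K : Type) [Field K] (n : ℕ) (I : List (Fin n)) : CohnAlgebra K n :=
  (I.map (cY K n)).prod

/-- The Leavitt relation `∑ x_i y_i = 1`; quotienting `C_K(n)` by this relation is
the same as quotienting by the two-sided ideal `M` generated by `1 - ∑ x_i y_i`. -/
inductive LeavittRel (K : Type) [Field K] (n : ℕ) :
    CohnAlgebra K n → CohnAlgebra K n → Prop
  | rel : LeavittRel K n (∑ i : Fin n, cX K n i * cY K n i) 1

/-- The Leavitt algebra `L_K(n) = C_K(n)/M`. -/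
abbrev LeavittAlgebra (K : Type) [Field K] (n : ℕ) := RingQuot (LeavittRel K n)

/-- The canonical quotient map `C_K(n) → L_K(n)`, `z ↦ z̄`. -/
def leavittQuot (K : Type) [Field K] (n : ℕ) : CohnAlgebra K n →ₐ[K] LeavittAlgebra K n :=
  RingQuot.mkAlgHom K (LeavittRel K n)

theorem cY_mul_cX (K : Type) [Field K] (n : ℕ) (i j : Fin n) :
    cY K n i * cX K n j = if i = j then 1 else 0 := by
  unfold cY cX
  rw [← map_mul, RingQuot.mkAlgHom_rel K (CohnRel.rel i j)]
  split_ifs <;> simp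

theorem xw_append (K : Type) [Field K] (n : ℕ) (A B : List (Fin n)) :
    xw K n (A ++ B) = xw K n A * xw K n B := by
  simp [xw]

theorem yw_append (K : Type) [Field K] (n : ℕ) (A B : List (Fin n)) :
    yw K n (A ++ B) = yw K n A * yw K n B := by
  simp [yw]

theorem yw_xw_cons (K : Type) [Field K] (n : ℕ) (a b : Fin n) (A B : List (Fin n)) :
    yw K n (a :: A).reverse * xw K n (b :: B)
      = yw K n A.reverse * (if a = b then 1 else 0) * xw K n B := by
  rw [← cY_mul_cX]
  simp [xw, yw, mul_assoc]

theorem yw_xw_self (K : Type) [Field K] (n : ℕ) (A : List (Fin n)) :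
    yw K n A.reverse * xw K n A = 1 := by
  induction A with
  | nil => simp [xw, yw]
  | cons a A ih => rw [yw_xw_cons]; simpa using ih

theorem yw_xw_zero (K : Type) [Field K] (n : ℕ) (A : List (Fin n)) :
    ∀ B : List (Fin n), ¬ A <+: B → ¬ B <+: A → yw K n A.reverse * xw K n B = 0 := by
  induction A with
  | nil => intro B h; simp at h
  | cons a A ih =>
    intro B h1 h2
    cases B with
    | nil => simp at h2
    | cons b B =>
      rw [yw_xw_cons]
      by_cases hab : a = b
      · subst hab
        simp only [List.cons_prefix_cons, true_and] at h1 h2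
        simpa using ih B h1 h2
      · simp [hab]

/-- Lemma 1.2(ii): the multiplication rule for basis elements of `C_K(n)`.
`I ≤ J` is the prefix order `List.IsPrefix`, and `I ∼ J` means `I ≤ J ∨ J ≤ I`. -/
theorem cohn_mult (K : Type) [Field K] (n : ℕ) (hn : 2 ≤ n)
    (I J K' L : List (Fin n)) :
    (¬ J.reverse <+: K' ∧ ¬ K' <+: J.reverse →
        (xw K n I * yw K n J) * (xw K n K' * yw K n L) = 0) ∧
    (∀ M : List (Fin n), K' = J.reverse ++ M →
        (xw K n I * yw K n J) * (xw K n K' * yw K n L) = xw K n (I ++ M) * yw K n L) ∧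
    (∀ N : List (Fin n), J.reverse = K' ++ N →
        (xw K n I * yw K n J) * (xw K n K' * yw K n L)
          = xw K n I * yw K n (N.reverse ++ L)) := by
  have key : (xw K n I * yw K n J) * (xw K n K' * yw K n L)
      = xw K n I * (yw K n J * xw K n K') * yw K n L := by simp only [mul_assoc]
  rw [key]
  obtain ⟨A, rfl⟩ : ∃ A : List (Fin n), J = A.reverse := ⟨J.reverse, by simp⟩
  simp only [List.reverse_reverse]
  refine ⟨?_, ?_, ?_⟩
  · rintro ⟨h1, h2⟩
    rw [yw_xw_zero K n A K' h1 h2]; simp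
  · rintro M rfl
    rw [xw_append, ← mul_assoc (yw K n A.reverse), yw_xw_self, one_mul, xw_append]
  · rintro N rfl
    rw [List.reverse_append, yw_append, mul_assoc (yw K n N.reverse), yw_xw_self, mul_one,
      yw_append, mul_assoc]
end
end

section
/- Let K be a field and n ≥ 2 an integer. The family { x̄_I : I a word in the alphabet {1,…,n} } is linearly independent in the Leavitt algebra L_K(n); in particular, for any finite set of distinct words I_1,…,I_V, the elements x̄_{I_1},…,x̄_{I_V} are K-linearly independent in L_K(n). -/
noncomputable section

open scoped BigOperators

abbrev LvS (n : ℕ) := (ℕ → Fin n) × ℤ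

def lvCons {n : ℕ} (i : Fin n) (s : ℕ → Fin n) : ℕ → Fin n
  | 0 => i
  | k + 1 => s k

def lvX (K : Type) [Field K] (n : ℕ) (i : Fin n) : Module.End K (LvS n → K) where
  toFun f p := if p.1 0 = i then f (fun k => p.1 (k + 1), p.2 - 1) else 0
  map_add' f g := by
    funext p; by_cases h : p.1 0 = i <;> simp [h]
  map_smul' c f := by
    funext p; by_cases h : p.1 0 = i <;> simp [h]

def lvY (K : Type) [Field K] (n : ℕ) (i : Fin n) : Module.End K (LvS n → K) where
  toFun f p := f (lvCons i p.1, p.2 + 1)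
  map_add' _ _ := rfl
  map_smul' _ _ := rfl

theorem lvYX (K : Type) [Field K] (n : ℕ) (i j : Fin n) :
    lvY K n i * lvX K n j = if i = j then 1 else 0 := by
  refine LinearMap.ext fun f => funext fun p => ?_
  by_cases h : i = j <;> simp [lvY, lvX, lvCons, h]

theorem lvXY (K : Type) [Field K] (n : ℕ) :
    ∑ i, lvX K n i * lvY K n i = 1 := by
  refine LinearMap.ext fun f => funext fun p => ?_
  have : lvCons (p.1 0) (fun k => p.1 (k + 1)) = p.1 := by
    funext k; cases k <;> rfl
  simp [LinearMap.sum_apply, Finset.sum_apply, lvY, lvX, this]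

def lvFree (K : Type) [Field K] (n : ℕ) :
    FreeAlgebra K (Fin n ⊕ Fin n) →ₐ[K] Module.End K (LvS n → K) :=
  FreeAlgebra.lift K (Sum.elim (lvX K n) (lvY K n))

def lvCohn (K : Type) [Field K] (n : ℕ) :
    CohnAlgebra K n →ₐ[K] Module.End K (LvS n → K) :=
  RingQuot.liftAlgHom K ⟨lvFree K n, by
    rintro _ _ ⟨i, j⟩
    rw [map_mul, lvFree, FreeAlgebra.lift_ι_apply, FreeAlgebra.lift_ι_apply]
    simp only [Sum.elim_inl, Sum.elim_inr, lvYX]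
    split_ifs <;> simp⟩

theorem lvCohn_X (K : Type) [Field K] (n : ℕ) (i : Fin n) :
    lvCohn K n (cX K n i) = lvX K n i := by
  simp [lvCohn, cX, lvFree]

theorem lvCohn_Y (K : Type) [Field K] (n : ℕ) (i : Fin n) :
    lvCohn K n (cY K n i) = lvY K n i := by
  simp [lvCohn, cY, lvFree]

def lvRep (K : Type) [Field K] (n : ℕ) :
    LeavittAlgebra K n →ₐ[K] Module.End K (LvS n → K) :=
  RingQuot.liftAlgHom K ⟨lvCohn K n, by
    rintro _ _ ⟨⟩
    simp only [map_sum, map_mul, lvCohn_X, lvCohn_Y, lvXY, map_one]⟩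

def lvPt {n : ℕ} (z : Fin n) : List (Fin n) → LvS n
  | [] => (fun _ => z, 0)
  | i :: I => (lvCons i (lvPt z I).1, (lvPt z I).2 + 1)

theorem lvPt_snd {n : ℕ} (z : Fin n) (I : List (Fin n)) : (lvPt z I).2 = I.length := by
  induction I with
  | nil => rfl
  | cons i I ih => simp [lvPt, ih]

theorem lvPt_inj {n : ℕ} (z : Fin n) : Function.Injective (lvPt z) := by
  intro I
  induction I with
  | nil =>
    intro J h
    have := congrArg Prod.snd h
    rw [lvPt_snd, lvPt_snd] at this
    cases J with
    | nil => rfl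
    | cons j J => simp at this; omega
  | cons i I ih =>
    intro J h
    have h2 := congrArg Prod.snd h
    have h1 := congrArg Prod.fst h
    cases J with
    | nil => rw [lvPt_snd, lvPt_snd] at h2; simp at h2; omega
    | cons j J =>
      have hij : i = j := congrFun h1 0
      have hs : (lvPt z I).1 = (lvPt z J).1 := funext fun k => congrFun h1 (k + 1)
      have ht : (lvPt z I).2 = (lvPt z J).2 := by simpa [lvPt] using h2
      rw [hij, ih (Prod.ext hs ht)]

open Classical in
theorem lvX_single (K : Type) [Field K] (n : ℕ) (i : Fin n) (w : LvS n) :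
    lvX K n i (Pi.single w 1) = Pi.single (lvCons i w.1, w.2 + 1) 1 := by
  funext p
  have key : (p.1 0 = i ∧ ((fun k => p.1 (k + 1), p.2 - 1) : LvS n) = w) ↔
      p = (lvCons i w.1, w.2 + 1) := by
    constructor
    · rintro ⟨h, rfl⟩
      refine Prod.ext (funext fun k => ?_) (by simp)
      cases k
      · exact h
      · rfl
    · rintro rfl
      exact ⟨rfl, Prod.ext rfl (by simp)⟩
  simp only [lvX, LinearMap.coe_mk, AddHom.coe_mk, Pi.single_apply, ← key]
  split_ifs <;> simp_all

open Classical in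
theorem lvRep_xw (K : Type) [Field K] (n : ℕ) (z : Fin n) (I : List (Fin n)) :
    lvRep K n (leavittQuot K n (xw K n I)) (Pi.single (lvPt z []) 1) =
      Pi.single (lvPt z I) 1 := by
  have h : ∀ c, lvRep K n (leavittQuot K n c) = lvCohn K n c := fun c => by
    simp [lvRep, leavittQuot]
  rw [h]
  induction I with
  | nil => simp [xw]
  | cons i I ih =>
    have : xw K n (i :: I) = cX K n i * xw K n I := by simp [xw]
    rw [this, map_mul, Module.End.mul_apply, ih, lvCohn_X, lvX_single]
    rfl

/-- Lemma 1.3: the family `x̄_I`, indexed by words `I`, is linearly independent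
in the Leavitt algebra `L_K(n)`; in particular any finitely many `x̄_I` with
distinct indices are `K`-linearly independent. -/
theorem xbar_linearIndependent (K : Type) [Field K] (n : ℕ) (hn : 2 ≤ n) :
    LinearIndependent K (fun I : List (Fin n) => leavittQuot K n (xw K n I)) := by
  classical
  let z : Fin n := ⟨0, by omega⟩
  let e : LeavittAlgebra K n →ₗ[K] (LvS n → K) :=
    (LinearMap.applyₗ (Pi.single (lvPt z []) 1)).comp (lvRep K n).toLinearMap
  have he : ∀ I, e (leavittQuot K n (xw K n I)) = Pi.single (lvPt z I) 1 :=
    fun I => lvRep_xw K n z I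
  have hli : LinearIndependent K (fun I => (Pi.single (lvPt z I) 1 : LvS n → K)) := by
    rw [linearIndependent_iff']
    intro s g hg J hJ
    have h := congrFun hg (lvPt z J)
    simp only [Finset.sum_apply, Pi.smul_apply, Pi.single_apply,
      (lvPt_inj z).eq_iff, Pi.zero_apply, smul_eq_mul, mul_ite, mul_one, mul_zero,
      Finset.sum_ite_eq, hJ, if_true] at h
    exact h
  refine LinearIndependent.of_comp e ?_
  have hc : (e ∘ fun I => leavittQuot K n (xw K n I)) =
      fun I => (Pi.single (lvPt z I) 1 : LvS n → K) := funext he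
  rw [hc]
  exact hli
end
end

section
/- Let K be a field, n ≥ 2 an integer, and let T : C_K(n) → K be any K-linear map satisfying T(x_I y_J) = 1 if I = J^rev and T(x_I y_J) = 0 if I ≠ J^rev, for all words I, J. Then T(c c') = T(c' c) for all c, c' ∈ C_K(n). -/
noncomputable section

open scoped BigOperators

theorem cohn_induction (K : Type) [Field K] (n : ℕ) (P : CohnAlgebra K n → Prop)
    (halg : ∀ r : K, P (algebraMap K _ r)) (hx : ∀ i, P (cX K n i)) (hy : ∀ i, P (cY K n i))
    (hmul : ∀ a b, P a → P b → P (a * b)) (hadd : ∀ a b, P a → P b → P (a + b)) :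
    ∀ c, P c := by
  intro c
  obtain ⟨a, rfl⟩ := RingQuot.mkAlgHom_surjective K (CohnRel K n) c
  induction a using FreeAlgebra.induction with
  | grade0 r => rw [AlgHom.commutes]; exact halg r
  | grade1 s =>
    cases s with
    | inl i => exact hx i
    | inr i => exact hy i
  | mul a b ha hb => rw [map_mul]; exact hmul _ _ ha hb
  | add a b ha hb => rw [map_add]; exact hadd _ _ ha hb

theorem xw_cons (K : Type) [Field K] (n : ℕ) (i : Fin n) (I : List (Fin n)) :
    xw K n (i :: I) = cX K n i * xw K n I := by simp [xw]

theorem yw_cons (K : Type) [Field K] (n : ℕ) (i : Fin n) (I : List (Fin n)) :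
    yw K n (i :: I) = cY K n i * yw K n I := by simp [yw]

theorem xw_snoc (K : Type) [Field K] (n : ℕ) (i : Fin n) (I : List (Fin n)) :
    xw K n (I ++ [i]) = xw K n I * cX K n i := by simp [xw]

theorem yw_snoc (K : Type) [Field K] (n : ℕ) (i : Fin n) (I : List (Fin n)) :
    yw K n (I ++ [i]) = yw K n I * cY K n i := by simp [yw]

theorem xw_nil (K : Type) [Field K] (n : ℕ) : xw K n [] = 1 := by simp [xw]

theorem yw_nil (K : Type) [Field K] (n : ℕ) : yw K n [] = 1 := by simp [yw]

theorem cY_mul_mono (K : Type) [Field K] (n : ℕ) (i a : Fin n) (I J : List (Fin n)) :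
    cY K n i * (xw K n (a :: I) * yw K n J) = if i = a then xw K n I * yw K n J else 0 := by
  rw [xw_cons, ← mul_assoc, ← mul_assoc, cY_mul_cX]
  split_ifs <;> simp

theorem mono_mul_cX (K : Type) [Field K] (n : ℕ) (i a : Fin n) (I J : List (Fin n)) :
    (xw K n I * yw K n (J ++ [a])) * cX K n i = if a = i then xw K n I * yw K n J else 0 := by
  rw [yw_snoc, mul_assoc, mul_assoc, cY_mul_cX]
  split_ifs <;> simp

def monoSpan (K : Type) [Field K] (n : ℕ) : Submodule K (CohnAlgebra K n) :=
  Submodule.span K (Set.range fun p : List (Fin n) × List (Fin n) => xw K n p.1 * yw K n p.2)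

theorem mono_mem (K : Type) [Field K] (n : ℕ) (I J : List (Fin n)) :
    xw K n I * yw K n J ∈ monoSpan K n := Submodule.subset_span ⟨(I, J), rfl⟩

theorem mem_monoSpan (K : Type) [Field K] (n : ℕ) (c : CohnAlgebra K n) : c ∈ monoSpan K n := by
  have key : ∀ c : CohnAlgebra K n, ∀ s ∈ monoSpan K n, c * s ∈ monoSpan K n := by
    have gen : ∀ c : CohnAlgebra K n, (∀ I J, c * (xw K n I * yw K n J) ∈ monoSpan K n) →
        ∀ s ∈ monoSpan K n, c * s ∈ monoSpan K n := by
      intro c h s hs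
      induction hs using Submodule.span_induction with
      | mem x hx => obtain ⟨⟨I, J⟩, rfl⟩ := hx; exact h I J
      | zero => rw [mul_zero]; exact Submodule.zero_mem _
      | add x y _ _ hx hy => rw [mul_add]; exact Submodule.add_mem _ hx hy
      | smul r x _ hx => rw [mul_smul_comm]; exact Submodule.smul_mem _ _ hx
    apply cohn_induction
    · intro r s hs
      rw [← Algebra.smul_def]; exact Submodule.smul_mem _ _ hs
    · intro i
      apply gen
      intro I J
      rw [← mul_assoc, ← xw_cons]; exact mono_mem K n _ _
    · intro i
      apply gen
      intro I J
      cases I with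
      | nil =>
        have := mono_mem K n [] (i :: J)
        simpa [xw_nil, yw_cons] using this
      | cons a I =>
        rw [cY_mul_mono]
        split_ifs
        · exact mono_mem K n _ _
        · exact Submodule.zero_mem _
    · intro a b ha hb s hs
      rw [mul_assoc]; exact ha _ (hb _ hs)
    · intro a b ha hb s hs
      rw [add_mul]; exact Submodule.add_mem _ (ha _ hs) (hb _ hs)
  have h1 := mono_mem K n [] []
  rw [xw_nil, yw_nil, mul_one] at h1
  simpa using key c 1 h1

/-- Proposition 2.3: the trace function `T : C_K(n) → K` satisfies
`T(c c') = T(c' c)`. -/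
theorem trace_comm (K : Type) [Field K] (n : ℕ) (hn : 2 ≤ n)
    (T : CohnAlgebra K n →ₗ[K] K)
    (hT : ∀ I J : List (Fin n),
      T (xw K n I * yw K n J) = if I = J.reverse then 1 else 0) :
    ∀ c c' : CohnAlgebra K n, T (c * c') = T (c' * c) := by
  have gen : ∀ c : CohnAlgebra K n,
      (∀ I J, T (c * (xw K n I * yw K n J)) = T ((xw K n I * yw K n J) * c)) →
      ∀ s, T (c * s) = T (s * c) := by
    intro c h s
    have hs := mem_monoSpan K n s
    unfold monoSpan at hs
    induction hs using Submodule.span_induction with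
    | mem x hx => obtain ⟨⟨I, J⟩, rfl⟩ := hx; exact h I J
    | zero => rw [mul_zero, zero_mul]
    | add x y _ _ hx hy => rw [mul_add, add_mul, map_add, map_add, hx, hy]
    | smul r x _ hx => rw [mul_smul_comm, smul_mul_assoc, map_smul, map_smul, hx]
  apply cohn_induction
  · intro r s
    rw [Algebra.commutes]
  · intro i
    apply gen
    intro I J
    rw [← mul_assoc, ← xw_cons, hT]
    rcases List.eq_nil_or_concat J with rfl | ⟨J, a, rfl⟩
    · have := hT (I ++ [i]) []
      rw [yw_nil, mul_one, xw_snoc] at this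
      rw [yw_nil, mul_one, this]
      simp
    · simp only [List.concat_eq_append] at *
      rw [mono_mul_cX, apply_ite T, hT, map_zero]
      by_cases h : a = i
      · simp [h]
      · simp [h, Ne.symm h]
  · intro i
    apply gen
    intro I J
    rw [mul_assoc (xw K n I), ← yw_snoc, hT]
    cases I with
    | nil =>
      have := hT [] (i :: J)
      rw [xw_nil, one_mul, yw_cons] at this
      rw [xw_nil, one_mul, this]
      simp
    | cons a I =>
      rw [cY_mul_mono, apply_ite T, hT, map_zero]
      by_cases h : a = i
      · simp [h]
      · simp [h, Ne.symm h]
  · intro a b ha hb s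
    rw [mul_assoc, ha, mul_assoc, hb, mul_assoc]
  · intro a b ha hb s
    rw [add_mul, mul_add, map_add, map_add, ha, hb]
end
end

section
/- Let K be a field and n ≥ 2 an integer with (n−1)·1_K = 0 in K, and let T : C_K(n) → K be any K-linear map satisfying T(x_I y_J) = 1 if I = J^rev and T(x_I y_J) = 0 if I ≠ J^rev, for all words I, J. Then T(m) = 0 for every element m of the two-sided ideal M of C_K(n) generated by 1 − Σ_{i=1}^n x_i y_i. -/
noncomputable section

open scoped BigOperators

/-- The idempotent generating `M`. -/
def cE (K : Type) [Field K] (n : ℕ) : CohnAlgebra K n :=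
  (1 : CohnAlgebra K n) - ∑ i : Fin n, cX K n i * cY K n i

theorem cY_mul_cE (K : Type) [Field K] (n : ℕ) (j : Fin n) : cY K n j * cE K n = 0 := by
  unfold cE
  rw [mul_sub, Finset.mul_sum]
  simp [← mul_assoc, cY_mul_cX]

theorem cE_mul_cX (K : Type) [Field K] (n : ℕ) (j : Fin n) : cE K n * cX K n j = 0 := by
  unfold cE
  rw [sub_mul, Finset.sum_mul]
  simp [mul_assoc, cY_mul_cX]

/-- The span of the `x_I e y_J`. -/
def cS (K : Type) [Field K] (n : ℕ) : Submodule K (CohnAlgebra K n) :=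
  Submodule.span K (Set.range fun p : List (Fin n) × List (Fin n) =>
    xw K n p.1 * cE K n * yw K n p.2)

theorem mem_cS (K : Type) [Field K] (n : ℕ) (I J : List (Fin n)) :
    xw K n I * cE K n * yw K n J ∈ cS K n :=
  Submodule.subset_span ⟨(I, J), rfl⟩

theorem cS_ind (K : Type) [Field K] (n : ℕ) (f : CohnAlgebra K n →ₗ[K] CohnAlgebra K n)
    (h : ∀ I J, f (xw K n I * cE K n * yw K n J) ∈ cS K n) :
    ∀ s ∈ cS K n, f s ∈ cS K n := by
  have : cS K n ≤ (cS K n).comap f := by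
    conv_lhs => unfold cS
    rw [Submodule.span_le]
    rintro _ ⟨⟨I, J⟩, rfl⟩
    exact h I J
  exact this

theorem cS_left (K : Type) [Field K] (n : ℕ) (a : CohnAlgebra K n) :
    ∀ s ∈ cS K n, a * s ∈ cS K n := by
  obtain ⟨a, rfl⟩ := RingQuot.mkAlgHom_surjective K (CohnRel K n) a
  induction a using FreeAlgebra.induction with
  | grade0 r =>
    intro s hs
    rw [AlgHom.commutes, ← Algebra.smul_def]
    exact Submodule.smul_mem _ _ hs
  | grade1 x =>
    apply cS_ind K n (LinearMap.mulLeft K _)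
    intro I J
    rw [LinearMap.mulLeft_apply]
    rcases x with i | i
    · change cX K n i * _ ∈ _
      have := mem_cS K n (i :: I) J
      simpa only [xw, List.map_cons, List.prod_cons, mul_assoc] using this
    · change cY K n i * _ ∈ _
      cases I with
      | nil => simp [xw, ← mul_assoc, cY_mul_cE]
      | cons k I =>
        have h : cY K n i * (xw K n (k :: I) * cE K n * yw K n J)
            = (cY K n i * cX K n k) * (xw K n I * cE K n * yw K n J) := by
          simp only [xw, List.map_cons, List.prod_cons, mul_assoc]
        rw [h, cY_mul_cX]
        split_ifs
        · rw [one_mul]; exact mem_cS K n I J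
        · rw [zero_mul]; exact Submodule.zero_mem _
  | mul a b ha hb =>
    intro s hs
    rw [map_mul, mul_assoc]
    exact ha _ (hb _ hs)
  | add a b ha hb =>
    intro s hs
    rw [map_add, add_mul]
    exact Submodule.add_mem _ (ha _ hs) (hb _ hs)

theorem cS_right (K : Type) [Field K] (n : ℕ) (a : CohnAlgebra K n) :
    ∀ s ∈ cS K n, s * a ∈ cS K n := by
  obtain ⟨a, rfl⟩ := RingQuot.mkAlgHom_surjective K (CohnRel K n) a
  induction a using FreeAlgebra.induction with
  | grade0 r =>
    intro s hs
    rw [AlgHom.commutes, ← Algebra.commutes, ← Algebra.smul_def]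
    exact Submodule.smul_mem _ _ hs
  | grade1 x =>
    apply cS_ind K n (LinearMap.mulRight K _)
    intro I J
    rw [LinearMap.mulRight_apply]
    rcases x with i | i
    · change _ * cX K n i ∈ _
      rcases List.eq_nil_or_concat J with rfl | ⟨J, k, rfl⟩
      · simp [yw, mul_assoc, cE_mul_cX]
      · have h : xw K n I * cE K n * yw K n (J ++ [k]) * cX K n i
            = (xw K n I * cE K n * yw K n J) * (cY K n k * cX K n i) := by
          simp only [yw, List.map_append, List.prod_append, List.map_cons, List.map_nil,
            List.prod_singleton, mul_assoc]
        rw [List.concat_eq_append, h, cY_mul_cX]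
        split_ifs
        · rw [mul_one]; exact mem_cS K n I J
        · rw [mul_zero]; exact Submodule.zero_mem _
    · change _ * cY K n i ∈ _
      have := mem_cS K n I (J ++ [i])
      simpa only [yw, List.map_append, List.prod_append, List.map_cons, List.map_nil,
            List.prod_singleton, mul_assoc] using this
  | mul a b ha hb =>
    intro s hs
    rw [map_mul, ← mul_assoc]
    exact hb _ (ha _ hs)
  | add a b ha hb =>
    intro s hs
    rw [map_add, mul_add]
    exact Submodule.add_mem _ (ha _ hs) (hb _ hs)

/-- Lemma 2.4: if `char K ∣ n - 1` then `T` vanishes on the two-sided ideal `M`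
of `C_K(n)` generated by `1 - ∑ x_i y_i`. -/
theorem trace_vanishes_on_M (K : Type) [Field K] (n : ℕ) (hn : 2 ≤ n)
    (hchar : ((n - 1 : ℕ) : K) = 0)
    (T : CohnAlgebra K n →ₗ[K] K)
    (hT : ∀ I J : List (Fin n),
      T (xw K n I * yw K n J) = if I = J.reverse then 1 else 0) :
    ∀ m ∈ TwoSidedIdeal.span
        {(1 : CohnAlgebra K n) - ∑ i : Fin n, cX K n i * cY K n i}, T m = 0 := by
  intro m hm
  have hmS : m ∈ cS K n := by
    rw [TwoSidedIdeal.mem_span_iff] at hm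
    have := hm (TwoSidedIdeal.mk' (cS K n : Set (CohnAlgebra K n)) (Submodule.zero_mem _)
      (fun h1 h2 => Submodule.add_mem _ h1 h2) (fun h => Submodule.neg_mem _ h)
      (fun h => cS_left K n _ _ h) (fun h => cS_right K n _ _ h)) (by
        rintro _ rfl
        rw [SetLike.mem_coe, TwoSidedIdeal.mem_mk']
        have h := mem_cS K n [] []
        simpa [xw, yw, cE] using h)
    rwa [TwoSidedIdeal.mem_mk'] at this
  have hle : cS K n ≤ LinearMap.ker T := by
    unfold cS
    rw [Submodule.span_le]
    rintro _ ⟨⟨I, J⟩, rfl⟩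
    have h : xw K n I * cE K n * yw K n J
        = xw K n I * yw K n J - ∑ i : Fin n, xw K n (I ++ [i]) * yw K n (i :: J) := by
      simp only [cE, xw, yw, mul_sub, sub_mul, mul_one, Finset.mul_sum, Finset.sum_mul,
        List.map_append, List.prod_append, List.map_cons, List.map_nil, List.prod_cons,
        List.prod_nil, mul_assoc, one_mul]
    have hn1 : (n : K) = 1 := by
      rw [Nat.cast_sub (by omega), Nat.cast_one] at hchar
      exact sub_eq_zero.mp hchar
    simp only [SetLike.mem_coe, LinearMap.mem_ker]
    rw [h, map_sub, map_sum]
    simp only [hT, List.reverse_cons, List.append_left_inj]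
    simp [hn1]
  exact hle hmS
end
end

section
/- Let K be a field and n ≥ 2 an integer with (n−1)·1_K = 0 in K. Then there exists a K-linear map τ : L_K(n) → K such that: τ(x̄_I ȳ_J) = 1 if I = J^rev and τ(x̄_I ȳ_J) = 0 if I ≠ J^rev for all words I, J; τ(l l') = τ(l' l) for all l, l' ∈ L_K(n); and τ(1_{L_K(n)}) = 1_K ≠ 0. -/
noncomputable section

open scoped BigOperators

namespace TauAux

variable (K : Type) [Field K] (n : ℕ)

/-- Space of functions on words. -/
abbrev V := List (Fin n) → K

/-- Shift operator. -/
def X (i : Fin n) : Module.End K (V K n) where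
  toFun f := fun w => match w with
    | [] => 0
    | j :: w' => if j = i then f w' else 0
  map_add' f g := by
    ext w
    cases w with
    | nil => simp
    | cons j w => by_cases h : j = i <;> simp [h]
  map_smul' c f := by
    ext w
    cases w with
    | nil => simp
    | cons j w => by_cases h : j = i <;> simp [h]

/-- Backward shift operator. -/
def Y (i : Fin n) : Module.End K (V K n) where
  toFun f := fun w => f (i :: w)
  map_add' f g := rfl
  map_smul' c f := rfl

@[simp] theorem X_nil (i : Fin n) (f : V K n) : X K n i f [] = 0 := rfl
@[simp] theorem X_cons (i j : Fin n) (f : V K n) (w : List (Fin n)) :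
    X K n i f (j :: w) = if j = i then f w else 0 := rfl
@[simp] theorem Y_apply (i : Fin n) (f : V K n) (w : List (Fin n)) :
    Y K n i f w = f (i :: w) := rfl

/-- Basis vector. -/
def e (w : List (Fin n)) : V K n := fun v => if v = w then 1 else 0

theorem X_e (i : Fin n) (w : List (Fin n)) : X K n i (e K n w) = e K n (i :: w) := by
  ext v
  cases v with
  | nil => simp [e]
  | cons j v => by_cases h : j = i <;> simp [e, h]

theorem Y_e_cons (i j : Fin n) (w : List (Fin n)) :
    Y K n i (e K n (j :: w)) = if j = i then e K n w else 0 := by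
  ext v
  by_cases h : j = i
  · simp [e, h]
  · simp [e, h, Ne.symm h]

theorem YX (i j : Fin n) : Y K n i * X K n j = if i = j then 1 else 0 := by
  ext f v
  by_cases h : i = j <;> simp [h, Module.End.mul_apply]

/-- The representation on words. -/
def rho : CohnAlgebra K n →ₐ[K] Module.End K (V K n) :=
  RingQuot.liftAlgHom K ⟨FreeAlgebra.lift K (Sum.elim (X K n) (Y K n)), by
    rintro _ _ ⟨i, j⟩
    rw [map_mul, FreeAlgebra.lift_ι_apply, FreeAlgebra.lift_ι_apply]
    simp only [Sum.elim_inl, Sum.elim_inr, YX]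
    split_ifs <;> simp⟩

@[simp] theorem rho_x (i : Fin n) : rho K n (cX K n i) = X K n i := by
  simp [rho, cX]
@[simp] theorem rho_y (i : Fin n) : rho K n (cY K n i) = Y K n i := by
  simp [rho, cY]

/-- Sum over words of length m. -/
def S : ℕ → V K n →ₗ[K] K
  | 0 => LinearMap.proj []
  | m + 1 => ∑ i : Fin n, (S m).comp (Y K n i)

theorem S_succ (m : ℕ) (g : V K n) : S K n (m+1) g = ∑ i : Fin n, S K n m (fun w => g (i :: w)) := by
  simp only [S, LinearMap.sum_apply, LinearMap.comp_apply]
  rfl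

theorem S_zero (m : ℕ) (g : V K n) (h : ∀ w, g w = 0) : S K n m g = 0 := by
  have : g = 0 := funext h
  rw [this, map_zero]

theorem S_one (h : (n : K) = 1) (m : ℕ) : S K n m (fun _ => 1) = 1 := by
  induction m with
  | zero => rfl
  | succ m ih => simp [S_succ, ih, h]

/-- Partial traces. -/
def t (m : ℕ) : CohnAlgebra K n →ₗ[K] K where
  toFun a := S K n m (fun w => rho K n a (e K n w) w)
  map_add' a b := by
    rw [← map_add]; congr 1; ext w; simp
  map_smul' c a := by
    rw [RingHom.id_apply, ← map_smul]; congr 1; ext w; simp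

theorem t_def (m : ℕ) (a : CohnAlgebra K n) :
    t K n m a = S K n m (fun w => rho K n a (e K n w) w) := rfl

theorem t_x (m : ℕ) (i : Fin n) (a : CohnAlgebra K n) :
    t K n (m+1) (cX K n i * a) = t K n m (a * cX K n i) := by
  rw [t_def, t_def, S_succ, Finset.sum_eq_single i]
  · congr 1; ext w; simp [X_e]
  · intro j _ h
    refine S_zero K n m _ fun w => ?_
    simp [h]
  · simp

theorem t_y (m : ℕ) (i : Fin n) (a : CohnAlgebra K n) :
    t K n (m+1) (a * cY K n i) = t K n m (cY K n i * a) := by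
  rw [t_def, t_def, S_succ, Finset.sum_eq_single i]
  · congr 1; ext w; simp [Y_e_cons]
  · intro j _ h
    refine S_zero K n m _ fun w => ?_
    simp [Y_e_cons, h]
  · simp

theorem t_rel (m : ℕ) (a : CohnAlgebra K n) :
    t K n (m+1) (a * (∑ i : Fin n, cX K n i * cY K n i - 1)) = 0 := by
  rw [t_def, S_succ]
  refine Finset.sum_eq_zero fun j _ => ?_
  refine S_zero K n m _ fun w => ?_
  have : ∑ i : Fin n, X K n i (Y K n i (e K n (j :: w))) = e K n (j :: w) := by
    rw [Finset.sum_eq_single j]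
    · simp [Y_e_cons, X_e]
    · intro i _ h
      simp [Y_e_cons, Ne.symm h]
    · simp
  simp [LinearMap.sum_apply, this]

/-- Eventual value. -/
def Ev (a : CohnAlgebra K n) (c : K) : Prop := ∃ N, ∀ m, N ≤ m → t K n m a = c

theorem yx (i j : Fin n) : cY K n i * cX K n j = if i = j then 1 else 0 := by
  have := RingQuot.mkAlgHom_rel K (CohnRel.rel (K := K) i j)
  rw [map_mul] at this
  rw [cX, cY, this]
  split_ifs <;> simp

theorem X_supp (I : List (Fin n)) (k : ℕ) (f : V K n) (hf : ∀ w, w.length ≠ k → f w = 0) :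
    ∀ w : List (Fin n), w.length ≠ k + I.length → rho K n (xw K n I) f w = 0 := by
  induction I with
  | nil => intro w hw; simpa [xw] using hf w hw
  | cons i I ih =>
    intro w hw
    have : xw K n (i :: I) = cX K n i * xw K n I := by simp [xw]
    rw [this]
    cases w with
    | nil => simp
    | cons j w =>
      simp only [map_mul, rho_x, Module.End.mul_apply, X_cons]
      split_ifs
      · apply ih
        simp only [List.length_cons] at hw
        omega
      · rfl

theorem Y_word (J : List (Fin n)) (f : V K n) (w : List (Fin n)) :
    rho K n (yw K n J) f w = f (J.reverse ++ w) := by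
  induction J generalizing w with
  | nil => simp [yw]
  | cons j J ih =>
    have : yw K n (j :: J) = cY K n j * yw K n J := by simp [yw]
    rw [this]
    simp [ih]

theorem Ev_word (h1 : (n : K) = 1) (I : List (Fin n)) : ∀ J : List (Fin n),
    Ev K n (xw K n I * yw K n J) (if I = J.reverse then 1 else 0) := by
  induction I with
  | nil =>
    intro J
    refine ⟨0, fun m _ => ?_⟩
    rw [t_def]
    by_cases hJ : J = []
    · subst hJ
      simpa [xw, yw, e] using S_one K n h1 m
    · rw [if_neg (fun h => hJ (List.reverse_eq_nil_iff.mp h.symm))]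
      refine S_zero K n m _ fun w => ?_
      have : xw K n [] = 1 := by simp [xw]
      simp [this, Y_word, e, hJ]
  | cons i I ih =>
    intro J
    have hx : xw K n (i :: I) = cX K n i * xw K n I := by simp [xw]
    rcases List.eq_nil_or_concat J with rfl | ⟨J, j, rfl⟩
    · refine ⟨0, fun m _ => ?_⟩
      rw [t_def]
      rw [if_neg (by simp)]
      refine S_zero K n m _ fun w => ?_
      have : yw K n [] = 1 := by simp [yw]
      rw [this, mul_one]
      apply X_supp K n (i :: I) w.length
      · intro v hv
        simp only [e]
        rw [if_neg]
        rintro rfl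
        exact hv rfl
      · simp
    · obtain ⟨N, hN⟩ := ih J
      refine ⟨N + 1, fun m hm => ?_⟩
      obtain ⟨m, rfl⟩ : ∃ m', m = m' + 1 := ⟨m - 1, by omega⟩
      have hy : yw K n (J.concat j) = yw K n J * cY K n j := by simp [yw]
      rw [hx, hy, mul_assoc, t_x, mul_assoc, mul_assoc, yx]
      by_cases h : j = i
      · subst h
        simp [hN m (by omega)]
      · simp [h, Ne.symm h]

/-- Span of normal forms. -/
def Sp : Submodule K (CohnAlgebra K n) :=
  Submodule.span K {a | ∃ I J, a = xw K n I * yw K n J}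

theorem Sp_mul (f : FreeAlgebra K (Fin n ⊕ Fin n)) :
    ∀ s ∈ Sp K n, RingQuot.mkAlgHom K (CohnRel K n) f * s ∈ Sp K n := by
  induction f using FreeAlgebra.induction with
  | grade0 r =>
    intro s hs
    rw [AlgHom.commutes, ← Algebra.smul_def]
    exact Submodule.smul_mem _ _ hs
  | grade1 g =>
    intro s hs
    refine Submodule.span_induction ?_ ?_ ?_ ?_ hs
    · rintro _ ⟨I, J, rfl⟩
      rcases g with i | i
      · apply Submodule.subset_span
        exact ⟨i :: I, J, by simp [xw, cX, mul_assoc]⟩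
      · change cY K n i * _ ∈ _
        cases I with
        | nil =>
          apply Submodule.subset_span
          exact ⟨[], i :: J, by simp [xw, yw]⟩
        | cons j I =>
          have hx : xw K n (j :: I) = cX K n j * xw K n I := by simp [xw]
          rw [hx, mul_assoc, ← mul_assoc, yx]
          split_ifs
          · rw [one_mul]
            exact Submodule.subset_span ⟨I, J, rfl⟩
          · simp
    · simp
    · intro a b _ _ ha hb
      rw [mul_add]
      exact Submodule.add_mem _ ha hb
    · intro c a _ ha
      rw [mul_smul_comm]
      exact Submodule.smul_mem _ _ ha
  | mul a b ha hb =>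
    intro s hs
    rw [map_mul, mul_assoc]
    exact ha _ (hb _ hs)
  | add a b ha hb =>
    intro s hs
    rw [map_add, add_mul]
    exact Submodule.add_mem _ (ha _ hs) (hb _ hs)

theorem mem_Sp (a : CohnAlgebra K n) : a ∈ Sp K n := by
  obtain ⟨f, rfl⟩ := RingQuot.mkAlgHom_surjective K (CohnRel K n) a
  have := Sp_mul K n f 1 (Submodule.subset_span ⟨[], [], by simp [xw, yw]⟩)
  simpa using this

variable {K n}

theorem Ev.add {a b : CohnAlgebra K n} {c d : K} (ha : Ev K n a c) (hb : Ev K n b d) :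
    Ev K n (a + b) (c + d) := by
  obtain ⟨N, hN⟩ := ha
  obtain ⟨M, hM⟩ := hb
  exact ⟨max N M, fun m hm => by
    rw [map_add, hN m (le_trans (le_max_left _ _) hm), hM m (le_trans (le_max_right _ _) hm)]⟩

theorem Ev.smul {a : CohnAlgebra K n} {c : K} (r : K) (ha : Ev K n a c) :
    Ev K n (r • a) (r * c) := by
  obtain ⟨N, hN⟩ := ha
  exact ⟨N, fun m hm => by rw [map_smul, hN m hm, smul_eq_mul]⟩

theorem Ev.unique {a : CohnAlgebra K n} {c d : K} (ha : Ev K n a c) (hb : Ev K n a d) :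
    c = d := by
  obtain ⟨N, hN⟩ := ha
  obtain ⟨M, hM⟩ := hb
  rw [← hN _ (le_max_left N M), hM _ (le_max_right N M)]

theorem Ev_exists (h1 : (n : K) = 1) (a : CohnAlgebra K n) : ∃ c, Ev K n a c := by
  refine Submodule.span_induction ?_ ?_ ?_ ?_ (mem_Sp K n a)
  · rintro _ ⟨I, J, rfl⟩
    exact ⟨_, Ev_word K n h1 I J⟩
  · exact ⟨0, 0, by simp⟩
  · rintro a b _ _ ⟨c, hc⟩ ⟨d, hd⟩
    exact ⟨_, hc.add hd⟩
  · rintro r a _ ⟨c, hc⟩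
    exact ⟨_, hc.smul r⟩

/-- Trace on the Cohn algebra. -/
def tauC (h1 : (n : K) = 1) : CohnAlgebra K n →ₗ[K] K where
  toFun a := (Ev_exists h1 a).choose
  map_add' a b := (Ev_exists h1 (a + b)).choose_spec.unique
    ((Ev_exists h1 a).choose_spec.add (Ev_exists h1 b).choose_spec)
  map_smul' r a := (Ev_exists h1 (r • a)).choose_spec.unique
    ((Ev_exists h1 a).choose_spec.smul r)

theorem tauC_spec (h1 : (n : K) = 1) (a : CohnAlgebra K n) : Ev K n a (tauC h1 a) :=
  (Ev_exists h1 a).choose_spec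

theorem tauC_eq (h1 : (n : K) = 1) {a : CohnAlgebra K n} {c : K} (h : Ev K n a c) :
    tauC h1 a = c := (tauC_spec h1 a).unique h

theorem tauC_shift (h1 : (n : K) = 1) {a b : CohnAlgebra K n}
    (h : ∀ m, t K n (m+1) a = t K n m b) : tauC h1 a = tauC h1 b := by
  apply tauC_eq
  obtain ⟨N, hN⟩ := tauC_spec h1 b
  refine ⟨N + 1, fun m hm => ?_⟩
  obtain ⟨m, rfl⟩ : ∃ m', m = m' + 1 := ⟨m - 1, by omega⟩
  rw [h, hN m (by omega)]

theorem tauC_comm (h1 : (n : K) = 1) (a b : CohnAlgebra K n) :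
    tauC h1 (a * b) = tauC h1 (b * a) := by
  obtain ⟨f, rfl⟩ := RingQuot.mkAlgHom_surjective K (CohnRel K n) a
  induction f using FreeAlgebra.induction generalizing b with
  | grade0 r => rw [AlgHom.commutes, Algebra.commutes]
  | grade1 g =>
    rcases g with i | i
    · exact tauC_shift h1 fun m => t_x K n m i b
    · exact (tauC_shift h1 fun m => t_y K n m i b).symm
  | mul p q hp hq =>
    rw [map_mul (RingQuot.mkAlgHom K (CohnRel K n)), mul_assoc, hp, mul_assoc, hq, mul_assoc]
  | add p q hp hq =>
    rw [map_add (RingQuot.mkAlgHom K (CohnRel K n)), add_mul, mul_add, map_add, map_add, hp, hq]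

/-- Radical of the trace form. -/
def rad (h1 : (n : K) = 1) : Ideal (CohnAlgebra K n) where
  carrier := {a | ∀ b, tauC h1 (b * a) = 0}
  add_mem' := by
    intro a b ha hb c
    rw [mul_add, map_add, ha, hb, add_zero]
  zero_mem' := by intro c; simp
  smul_mem' := by
    intro c a ha b
    rw [smul_eq_mul, ← mul_assoc, ha]

instance (h1 : (n : K) = 1) : (rad h1).IsTwoSided := ⟨by
  intro a b ha c
  rw [← mul_assoc, tauC_comm, ← mul_assoc, ha]⟩

/-- Map from the Leavitt algebra. -/
def toQ (h1 : (n : K) = 1) : LeavittAlgebra K n →ₐ[K] CohnAlgebra K n ⧸ rad h1 :=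
  RingQuot.liftAlgHom K ⟨Ideal.Quotient.mkₐ K (rad h1), by
    rintro _ _ ⟨⟩
    refine Ideal.Quotient.eq.mpr ?_
    intro b
    refine tauC_eq h1 ⟨1, fun m hm => ?_⟩
    obtain ⟨m, rfl⟩ : ∃ m', m = m' + 1 := ⟨m - 1, by omega⟩
    exact t_rel K n m b⟩

theorem toQ_quot (h1 : (n : K) = 1) (a : CohnAlgebra K n) :
    toQ h1 (leavittQuot K n a) = Ideal.Quotient.mkₐ K (rad h1) a := by
  simp [toQ, leavittQuot]

/-- Induced functional. -/
def tauQ (h1 : (n : K) = 1) : (CohnAlgebra K n ⧸ rad h1) →ₗ[K] K where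
  toFun := Quotient.lift (s := Submodule.quotientRel (rad h1)) (fun a => tauC h1 a) (by
    intro a b hab
    have h : a - b ∈ rad h1 := (Submodule.quotientRel_def _).mp hab
    have := h 1
    rw [one_mul, map_sub, sub_eq_zero] at this
    exact this)
  map_add' a b := by
    obtain ⟨a, rfl⟩ := Ideal.Quotient.mk_surjective a
    obtain ⟨b, rfl⟩ := Ideal.Quotient.mk_surjective b
    exact map_add (tauC h1) a b
  map_smul' r a := by
    obtain ⟨a, rfl⟩ := Ideal.Quotient.mk_surjective a
    exact map_smul (tauC h1) r a

theorem exists_tau (h1 : (n : K) = 1) : ∃ τ : LeavittAlgebra K n →ₗ[K] K,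
    ∀ a, τ (leavittQuot K n a) = tauC h1 a :=
  ⟨(tauQ h1).comp (toQ h1).toLinearMap, fun a => by
    change tauQ h1 (toQ h1 (leavittQuot K n a)) = _
    rw [toQ_quot]
    rfl⟩

end TauAux

/-- Definition 2.5 / Proposition 2.6: if `char K ∣ n - 1` there is a `K`-linear
trace `τ : L_K(n) → K` with `τ(x̄_I ȳ_J) = δ_{I, J^rev}`, `τ(l l') = τ(l' l)`,
and `τ(1) = 1 ≠ 0`. -/
theorem tau_exists (K : Type) [Field K] (n : ℕ) (hn : 2 ≤ n)
    (hchar : ((n - 1 : ℕ) : K) = 0) :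
    ∃ τ : LeavittAlgebra K n →ₗ[K] K,
      (∀ I J : List (Fin n),
        τ (leavittQuot K n (xw K n I) * leavittQuot K n (yw K n J))
          = if I = J.reverse then 1 else 0) ∧
      (∀ l l' : LeavittAlgebra K n, τ (l * l') = τ (l' * l)) ∧
      τ 1 = 1 ∧ (1 : K) ≠ 0 := by
  have h1 : (n : K) = 1 := by
    obtain ⟨m, rfl⟩ : ∃ m, n = m + 1 := ⟨n - 1, by omega⟩
    simpa using hchar
  obtain ⟨τ, hτ⟩ := TauAux.exists_tau h1
  have hw : ∀ I J : List (Fin n),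
        τ (leavittQuot K n (xw K n I) * leavittQuot K n (yw K n J))
          = if I = J.reverse then 1 else 0 := by
    intro I J
    rw [← map_mul, hτ]
    exact TauAux.tauC_eq h1 (TauAux.Ev_word K n h1 I J)
  refine ⟨τ, hw, ?_, ?_, one_ne_zero⟩
  · intro l l'
    obtain ⟨a, rfl⟩ := RingQuot.mkAlgHom_surjective K (LeavittRel K n) l
    obtain ⟨b, rfl⟩ := RingQuot.mkAlgHom_surjective K (LeavittRel K n) l'
    change τ (leavittQuot K n a * leavittQuot K n b) = τ (leavittQuot K n b * leavittQuot K n a)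
    rw [← map_mul, ← map_mul, hτ, hτ, TauAux.tauC_comm]
  · simpa [xw, yw] using hw [] []
end
end

section
/- Let K be a field, let n ≥ 2 and d ≥ 1 be integers, and assume (n−1)·1_K = 0 in K. Then there exists a K-linear functional τ_d : M_d(L_K(n)) → K such that τ_d(BC) = τ_d(CB) for all B, C ∈ M_d(L_K(n)) and τ_d(1_{M_d(L_K(n))}) = d·1_K. -/
noncomputable section

open scoped BigOperators

namespace LTr

open Filter

variable (K : Type) [Field K] (n : ℕ)

abbrev X (n : ℕ) := ℤ × (ℕ → Fin n)

variable {n} in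
def cons (i : Fin n) (x : X n) : X n := (x.1 + 1, fun m => Nat.casesOn m i x.2)

variable {n} in
def hd (x : X n) : Fin n := x.2 0

variable {n} in
def tl (x : X n) : X n := (x.1 - 1, fun m => x.2 (m + 1))

variable {n} in
@[simp] lemma hd_cons (i : Fin n) (x : X n) : hd (cons i x) = i := rfl

variable {n} in
@[simp] lemma tl_cons (i : Fin n) (x : X n) : tl (cons i x) = x := by
  ext <;> simp [tl, cons]

variable {n} in
@[simp] lemma cons_hd_tl (x : X n) : cons (hd x) (tl x) = x := by
  ext m
  · simp [tl, cons]
  · cases m <;> simp [tl, cons, hd]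

variable {n} in
@[simp] lemma cons_inj (i j : Fin n) (x y : X n) : cons i x = cons j y ↔ i = j ∧ x = y := by
  constructor
  · intro h
    have h1 := congrArg hd h
    have h2 := congrArg tl h
    simp at h1 h2
    exact ⟨h1, h2⟩
  · rintro ⟨rfl, rfl⟩; rfl

def oX (i : Fin n) : Module.End K (X n → K) where
  toFun v := fun x => if hd x = i then v (tl x) else 0
  map_add' u v := by ext x; by_cases h : hd x = i <;> simp [h]
  map_smul' c v := by ext x; by_cases h : hd x = i <;> simp [h]

def oY (i : Fin n) : Module.End K (X n → K) where
  toFun v := fun x => v (cons i x)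
  map_add' _ _ := rfl
  map_smul' _ _ := rfl

lemma oX_cons (i j : Fin n) (v : X n → K) (x : X n) :
    oX K n i v (cons j x) = if i = j then v x else 0 := by
  simp [oX, eq_comm]

lemma oY_app (i : Fin n) (v : X n → K) (x : X n) : oY K n i v x = v (cons i x) := rfl

open Classical in
def e (x : X n) : X n → K := Pi.single x 1

open Classical in
lemma e_app (x z : X n) : e K n x z = if z = x then 1 else 0 := by
  simp [e, Pi.single_apply]

lemma oX_e (i : Fin n) (x : X n) : oX K n i (e K n x) = e K n (cons i x) := by
  ext z
  obtain ⟨j, y, rfl⟩ : ∃ j y, z = cons j y := ⟨hd z, tl z, (cons_hd_tl z).symm⟩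
  rw [oX_cons, e_app, e_app]
  have := cons_inj j i y x
  by_cases h : i = j
  · subst h
    by_cases h' : y = x <;> simp_all
  · have h' : ¬ j = i := fun q => h q.symm
    simp_all

lemma oY_e (i j : Fin n) (x : X n) :
    oY K n i (e K n (cons j x)) = if i = j then e K n x else 0 := by
  ext z
  rw [oY_app]
  have := cons_inj i j z x
  by_cases h : i = j
  · subst h
    by_cases h' : z = x <;> simp_all [e_app]
  · simp_all [e_app]

def repF : FreeAlgebra K (Fin n ⊕ Fin n) →ₐ[K] Module.End K (X n → K) :=
  FreeAlgebra.lift K (Sum.elim (oX K n) (oY K n))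

def repC : CohnAlgebra K n →ₐ[K] Module.End K (X n → K) :=
  RingQuot.liftAlgHom K ⟨repF K n, by
    rintro _ _ ⟨i, j⟩
    rw [map_mul]
    ext v x
    by_cases h : i = j <;> simp [repF, oY_app, oX_cons, h, eq_comm]⟩

lemma repC_X (i : Fin n) : repC K n (cX K n i) = oX K n i := by
  simp [repC, cX, repF]

lemma repC_Y (i : Fin n) : repC K n (cY K n i) = oY K n i := by
  simp [repC, cY, repF]

def rep : LeavittAlgebra K n →ₐ[K] Module.End K (X n → K) :=
  RingQuot.liftAlgHom K ⟨repC K n, by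
    rintro _ _ ⟨⟩
    simp only [map_sum, map_mul, map_one, repC_X, repC_Y]
    ext v x
    obtain ⟨j, y, rfl⟩ : ∃ j y, x = cons j y := ⟨hd x, tl x, (cons_hd_tl x).symm⟩
    simp [LinearMap.sum_apply, Finset.sum_apply, oX_cons, oY_app]⟩

def lX (i : Fin n) : LeavittAlgebra K n := leavittQuot K n (cX K n i)
def lY (i : Fin n) : LeavittAlgebra K n := leavittQuot K n (cY K n i)

@[simp] lemma rep_X (i : Fin n) : rep K n (lX K n i) = oX K n i := by
  simp [rep, lX, leavittQuot, repC_X]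

@[simp] lemma rep_Y (i : Fin n) : rep K n (lY K n i) = oY K n i := by
  simp [rep, lY, leavittQuot, repC_Y]

lemma lYX (i j : Fin n) : lY K n i * lX K n j = if i = j then 1 else 0 := by
  rw [lY, lX, ← map_mul, cY, cX, ← map_mul, RingQuot.mkAlgHom_rel K (CohnRel.rel i j)]
  split_ifs <;> simp

lemma ind (P : LeavittAlgebra K n → Prop)
    (hs : ∀ c : K, P (algebraMap K _ c)) (hX : ∀ i, P (lX K n i)) (hY : ∀ i, P (lY K n i))
    (hm : ∀ a b, P a → P b → P (a * b)) (ha : ∀ a b, P a → P b → P (a + b)) (a) : P a := by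
  obtain ⟨c, rfl⟩ := RingQuot.mkAlgHom_surjective K (LeavittRel K n) a
  obtain ⟨f, rfl⟩ := RingQuot.mkAlgHom_surjective K (CohnRel K n) c
  induction f using FreeAlgebra.induction with
  | grade0 r => simpa using hs r
  | grade1 x =>
    rcases x with i | i
    · exact hX i
    · exact hY i
  | mul a b h1 h2 => simpa only [map_mul] using hm _ _ h1 h2
  | add a b h1 h2 => simpa only [map_add] using ha _ _ h1 h2

def A (x0 : X n) : ℕ → (X n → K) →ₗ[K] K
  | 0 => LinearMap.proj x0
  | N + 1 => ∑ i : Fin n, (A x0 N) ∘ₗ (oY K n i)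

lemma A_succ (x0 : X n) (N : ℕ) (g : X n → K) :
    A K n x0 (N + 1) g = ∑ i, A K n x0 N (fun x => g (cons i x)) := by
  simp only [A, LinearMap.sum_apply]; rfl

def diag : LeavittAlgebra K n →ₗ[K] (X n → K) where
  toFun a := fun x => rep K n a (e K n x) x
  map_add' a b := by ext x; simp
  map_smul' c a := by ext x; simp

lemma diag_app (a) (x : X n) : diag K n a x = rep K n a (e K n x) x := rfl

def T (x0 : X n) (N : ℕ) : LeavittAlgebra K n →ₗ[K] K := A K n x0 N ∘ₗ diag K n

lemma T_X (x0 : X n) (N : ℕ) (i : Fin n) (b) :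
    T K n x0 (N + 1) (lX K n i * b) = T K n x0 N (b * lX K n i) := by
  simp only [T, LinearMap.comp_apply, A_succ]
  rw [Finset.sum_eq_single i]
  · congr 1; ext x
    simp [diag_app, oX_cons, oX_e]
  · intro j _ hj
    convert map_zero (A K n x0 N)
    simp [diag_app, oX_cons, hj.symm]
  · simp

lemma T_Y (x0 : X n) (N : ℕ) (i : Fin n) (b) :
    T K n x0 (N + 1) (b * lY K n i) = T K n x0 N (lY K n i * b) := by
  simp only [T, LinearMap.comp_apply, A_succ]
  rw [Finset.sum_eq_single i]
  · congr 1; ext x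
    simp [diag_app, oY_app, oY_e]
  · intro j _ hj
    convert map_zero (A K n x0 N)
    simp [diag_app, oY_e, hj.symm]
  · simp

lemma T_one (hc : (n : K) = 1) (x0 : X n) (N : ℕ) : T K n x0 N 1 = 1 := by
  have h : diag K n 1 = fun _ => 1 := by ext x; simp [diag_app, e]
  simp only [T, LinearMap.comp_apply, h]
  induction N with
  | zero => simp [A]
  | succ N ih => rw [A_succ]; simp [ih, hc]

def wX (I : List (Fin n)) : LeavittAlgebra K n := (I.map (lX K n)).prod
def wY (I : List (Fin n)) : LeavittAlgebra K n := (I.map (lY K n)).prod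

lemma wX_e (I : List (Fin n)) (x : X n) :
    ∃ z : X n, z.1 = x.1 + I.length ∧ rep K n (wX K n I) (e K n x) = e K n z := by
  induction I with
  | nil => exact ⟨x, by simp, by simp [wX]⟩
  | cons i I ih =>
    obtain ⟨z, h1, h2⟩ := ih
    refine ⟨cons i z, by simp [cons, h1]; ring, ?_⟩
    simp only [wX] at h2
    simp [wX, h2, oX_e]

lemma wY_app (J : List (Fin n)) (x : X n) :
    ∃ z : X n, z.1 = x.1 + J.length ∧ ∀ v, rep K n (wY K n J) v x = v z := by
  induction J generalizing x with
  | nil => exact ⟨x, by simp, by simp [wY]⟩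
  | cons i I ih =>
    obtain ⟨z, h1, h2⟩ := ih (cons i x)
    refine ⟨z, by simp [cons, h1]; ring, fun v => ?_⟩
    have := h2 v
    simp only [wY] at this
    simp [wY, oY_app, this]

lemma diag_wX (i) (I : List (Fin n)) : diag K n (wX K n (i :: I)) = 0 := by
  ext x
  obtain ⟨z, h1, h2⟩ := wX_e K n (i :: I) x
  rw [diag_app, h2]
  have : x ≠ z := by
    rintro rfl
    simp at h1; omega
  simp [e, this]

lemma diag_wY (i) (I : List (Fin n)) : diag K n (wY K n (i :: I)) = 0 := by
  ext x
  obtain ⟨z, h1, h2⟩ := wY_app K n (i :: I) x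
  rw [diag_app, h2]
  have : z ≠ x := by
    rintro rfl
    simp at h1; omega
  simp [e, this]

def stable (x0 : X n) : Submodule K (LeavittAlgebra K n) where
  carrier := {a | ∃ c : K, ∀ᶠ N in atTop, T K n x0 N a = c}
  zero_mem' := ⟨0, by simp⟩
  add_mem' := by
    rintro a b ⟨c, hc⟩ ⟨d, hd⟩
    refine ⟨c + d, ?_⟩
    filter_upwards [hc, hd] with N h1 h2
    rw [map_add, h1, h2]
  smul_mem' := by
    rintro r a ⟨c, hc⟩
    refine ⟨r * c, ?_⟩
    filter_upwards [hc] with N h1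
    rw [map_smul, h1, smul_eq_mul]

lemma ev_succ {p : ℕ → Prop} : (∀ᶠ N in atTop, p (N + 1)) ↔ ∀ᶠ N in atTop, p N := by
  conv_rhs => rw [← Filter.map_add_atTop_eq_nat 1, Filter.eventually_map]

lemma stable_w (hc : (n : K) = 1) (x0 : X n) (I J : List (Fin n)) :
    wX K n I * wY K n J ∈ stable K n x0 := by
  induction I generalizing J with
  | nil =>
    cases J with
    | nil => exact ⟨1, by simp [wX, wY, T_one K n hc]⟩
    | cons j J =>
      refine ⟨0, Eventually.of_forall fun N => ?_⟩
      have : wX K n [] = 1 := by simp [wX]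
      rw [this, one_mul, T, LinearMap.comp_apply, diag_wY, map_zero]
  | cons i I ih =>
    rcases List.eq_nil_or_concat J with rfl | ⟨J, j, rfl⟩
    · refine ⟨0, Eventually.of_forall fun N => ?_⟩
      have : wY K n [] = 1 := by simp [wY]
      rw [this, mul_one, T, LinearMap.comp_apply, diag_wX, map_zero]
    · obtain ⟨c, h⟩ := ih J
      refine ⟨if j = i then c else 0, ?_⟩
      rw [← ev_succ]
      filter_upwards [h] with N hN
      have h1 : wX K n (i :: I) * wY K n (J.concat j)
          = lX K n i * (wX K n I * wY K n J * lY K n j) := by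
        simp [wX, wY, mul_assoc]
      rw [h1, T_X, mul_assoc, lYX]
      split_ifs <;> simp [hN]

lemma span_top : Submodule.span K
    (Set.range fun p : List (Fin n) × List (Fin n) => wX K n p.1 * wY K n p.2) = ⊤ := by
  set P := Submodule.span K
    (Set.range fun p : List (Fin n) × List (Fin n) => wX K n p.1 * wY K n p.2) with hP
  have mem : ∀ I J, wX K n I * wY K n J ∈ P := fun I J => Submodule.subset_span ⟨(I, J), rfl⟩
  have key : ∀ g : LeavittAlgebra K n, (∀ I J, g * (wX K n I * wY K n J) ∈ P) →
      ∀ p ∈ P, g * p ∈ P := by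
    intro g hg p hp
    have : P ≤ P.comap (LinearMap.mulLeft K g) := by
      conv_lhs => rw [hP]
      rw [Submodule.span_le]
      rintro _ ⟨⟨I, J⟩, rfl⟩
      exact hg I J
    exact this hp
  have all : ∀ a, ∀ p ∈ P, a * p ∈ P := by
    intro a
    refine ind K n (fun a => ∀ p ∈ P, a * p ∈ P) ?_ ?_ ?_ ?_ ?_ a
    · intro c p hp
      rw [← Algebra.smul_def]
      exact P.smul_mem c hp
    · intro i
      apply key
      intro I J
      have := mem (i :: I) J
      simpa [wX, mul_assoc] using this
    · intro i
      apply key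
      intro I J
      cases I with
      | nil =>
        have := mem [] (i :: J)
        simpa [wX, wY] using this
      | cons j I =>
        have h1 : lY K n i * (wX K n (j :: I) * wY K n J)
            = (lY K n i * lX K n j) * (wX K n I * wY K n J) := by
          simp [wX, mul_assoc]
        rw [h1, lYX]
        split_ifs
        · simpa using mem I J
        · simp
    · intro a b h1 h2 p hp
      rw [mul_assoc]; exact h1 _ (h2 _ hp)
    · intro a b h1 h2 p hp
      rw [add_mul]; exact P.add_mem (h1 _ hp) (h2 _ hp)
  rw [eq_top_iff]
  intro a _
  have := all a 1 (by simpa [wX, wY] using mem [] [])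
  simpa using this

lemma exists_tau (hn : 2 ≤ n) (hc : (n : K) = 1) : ∃ τ : LeavittAlgebra K n →ₗ[K] K,
    (∀ a b, τ (a * b) = τ (b * a)) ∧ τ 1 = 1 := by
  let x0 : X n := (0, fun _ => ⟨0, by omega⟩)
  have hs : ∀ a, ∃ c : K, ∀ᶠ N in atTop, T K n x0 N a = c := by
    have : stable K n x0 = ⊤ := by
      rw [eq_top_iff, ← span_top, Submodule.span_le]
      rintro _ ⟨⟨I, J⟩, rfl⟩
      exact stable_w K n hc x0 I J
    intro a
    have h : a ∈ stable K n x0 := this ▸ Submodule.mem_top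
    exact h
  choose f hf using hs
  have uniq : ∀ a c, (∀ᶠ N in atTop, T K n x0 N a = c) → f a = c := by
    intro a c h
    obtain ⟨N, h1, h2⟩ := ((hf a).and h).exists
    exact h1.symm.trans h2
  let τ : LeavittAlgebra K n →ₗ[K] K :=
    { toFun := f
      map_add' := by
        intro a b
        apply uniq
        filter_upwards [hf a, hf b] with N h1 h2
        rw [map_add, h1, h2]
      map_smul' := by
        intro r a
        apply uniq
        filter_upwards [hf a] with N h1
        rw [map_smul, h1]; rfl }
  have hτ : ∀ a, τ a = f a := fun _ => rfl
  refine ⟨τ, ?_, ?_⟩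
  · intro a
    refine ind K n (fun a => ∀ b, τ (a * b) = τ (b * a)) ?_ ?_ ?_ ?_ ?_ a
    · intro c b
      rw [Algebra.commutes]
    · intro i b
      rw [hτ, hτ]
      apply uniq
      rw [← ev_succ]
      filter_upwards [hf (b * lX K n i)] with N h
      rw [T_X, h]
    · intro i b
      rw [hτ, hτ]
      symm
      apply uniq
      rw [← ev_succ]
      filter_upwards [hf (lY K n i * b)] with N h
      rw [T_Y, h]
    · intro a a' h1 h2 b
      rw [mul_assoc, h1, mul_assoc, h2, mul_assoc]
    · intro a a' h1 h2 b
      rw [add_mul, mul_add, map_add, map_add, h1, h2]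
  · exact uniq 1 1 (Eventually.of_forall fun N => T_one K n hc x0 N)

end LTr

/-- Corollary 2.8: if `char K ∣ n - 1` then `M_d(L_K(n))` admits a trace
function `τ_d`, which moreover satisfies `τ_d(1) = d · 1_K`. -/
theorem tau_d_exists (K : Type) [Field K] (n d : ℕ) (hn : 2 ≤ n) (hd : 1 ≤ d)
    (hchar : ((n - 1 : ℕ) : K) = 0) :
    ∃ τd : Matrix (Fin d) (Fin d) (LeavittAlgebra K n) →ₗ[K] K,
      (∀ B C : Matrix (Fin d) (Fin d) (LeavittAlgebra K n),
        τd (B * C) = τd (C * B)) ∧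
      τd 1 = (d : K) := by
  obtain ⟨τ, h1, h2⟩ := LTr.exists_tau K n hn (by
    have h : n = (n - 1) + 1 := by omega
    rw [h, Nat.cast_add, hchar]; simp)
  refine ⟨τ ∘ₗ Matrix.traceLinearMap (Fin d) K (LeavittAlgebra K n), ?_, ?_⟩
  · intro B C
    simp only [LinearMap.comp_apply, Matrix.traceLinearMap_apply, Matrix.trace, Matrix.diag_apply,
      Matrix.mul_apply, map_sum]
    rw [Finset.sum_comm]
    exact Finset.sum_congr rfl fun i _ => Finset.sum_congr rfl fun j _ => h1 _ _
  · simp only [LinearMap.comp_apply, Matrix.traceLinearMap_apply, Matrix.trace, Matrix.diag_apply,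
      Matrix.one_apply_eq, map_sum, h2]
    simp
end
end
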